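/- arXiv:2003.09397 — 6 statements merged into one kernel-verified Lean document; each statement's English description precedes it below -/
import Mathlib

section
/- For every p₀ ∈ (0,1) and q₀ > 0, setting E = q₀² − A(p₀), one has E > −1/4 and there exists a unique p₊ > p_* with A(p₊) = −E; moreover p₊ > p₀, and p₊ < 1 if and only if E < 0. If in addition E < 0, there exists a unique p₋ ∈ (0, p_*) with A(p₋) = −E, and then 0 < p₋ < p₀ and the ordering 0 < p₋ < p_* < p₊ < 1 holds. -/
open Real MeasureTheory Set Filter Topology

/-- The potential `A(u) = u²(1 − u²)`. -/
noncomputable def A (u : ℝ) : ℝ := u ^ 2 * (1 - u ^ 2)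

/-- `p⋆ = 1/√2`, the unique positive critical point of `A`, with `A p⋆ = 1/4`. -/
noncomputable def pstar : ℝ := 1 / Real.sqrt 2

/-- For energy `E > −1/4`, the unique root `p₊ > p⋆` of `A(p₊) = −E` (explicit formula). -/
noncomputable def pPlus (E : ℝ) : ℝ := Real.sqrt ((1 + Real.sqrt (1 + 4 * E)) / 2)

/-- For energy `E ∈ (−1/4, 0)`, the unique root `p₋ ∈ (0, p⋆)` of `A(p₋) = −E` (explicit formula). -/
noncomputable def pMinus (E : ℝ) : ℝ := Real.sqrt ((1 - Real.sqrt (1 + 4 * E)) / 2)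

/-- The period function `T₊(p₀,q₀) = ∫_{p₀}^{p₊} du/√(E + A(u))`, `E = q₀² − A(p₀)`. -/
noncomputable def Tplus (p₀ q₀ : ℝ) : ℝ :=
  ∫ u in p₀..pPlus (q₀ ^ 2 - A p₀), 1 / Real.sqrt ((q₀ ^ 2 - A p₀) + A u)

/-- The period function `T₋(p₀,q₀) = ∫_{p₋}^{p₀} du/√(E + A(u))`, `E = q₀² − A(p₀)`. -/
noncomputable def Tminus (p₀ q₀ : ℝ) : ℝ :=
  ∫ u in pMinus (q₀ ^ 2 - A p₀)..p₀, 1 / Real.sqrt ((q₀ ^ 2 - A p₀) + A u)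

theorem A_eq_sub_sq (u : ℝ) : A u = 1 / 4 - (u ^ 2 - 1 / 2) ^ 2 := by
  unfold A; ring

theorem A_one : A 1 = 0 := by norm_num [A]

theorem pstar_pos : 0 < pstar := by unfold pstar; positivity

theorem pstar_sq : pstar ^ 2 = 1 / 2 := by norm_num [pstar, div_pow]

theorem pstar_lt_one : pstar < 1 := by
  nlinarith [pstar_sq, pstar_pos]

theorem strictAntiOn_A : StrictAntiOn A (Ici pstar) := by
  intro u hu v _ huv
  have hu' : pstar ≤ u := hu
  have h₁ : pstar ^ 2 ≤ u ^ 2 := pow_le_pow_left₀ pstar_pos.le hu' 2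
  have h₂ : u ^ 2 < v ^ 2 := pow_lt_pow_left₀ huv (pstar_pos.le.trans hu') two_ne_zero
  rw [pstar_sq] at h₁
  rw [A_eq_sub_sq, A_eq_sub_sq]
  nlinarith

theorem strictMonoOn_A : StrictMonoOn A (Icc 0 pstar) := by
  intro u hu v hv huv
  have h₁ : v ^ 2 ≤ pstar ^ 2 := pow_le_pow_left₀ hv.1 hv.2 2
  have h₂ : u ^ 2 < v ^ 2 := pow_lt_pow_left₀ huv hu.1 two_ne_zero
  rw [pstar_sq] at h₁
  rw [A_eq_sub_sq, A_eq_sub_sq]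
  nlinarith

theorem pstar_lt_pPlus {E : ℝ} (hE : -1 / 4 < E) : pstar < pPlus E := by
  have hs : 0 < √(1 + 4 * E) := Real.sqrt_pos.2 (by linarith)
  refine Real.lt_sqrt_of_sq_lt ?_
  rw [pstar_sq]
  linarith

theorem A_pPlus {E : ℝ} (hE : -1 / 4 ≤ E) : A (pPlus E) = -E := by
  have hs : √(1 + 4 * E) ^ 2 = 1 + 4 * E := Real.sq_sqrt (by linarith)
  have hp : pPlus E ^ 2 = (1 + √(1 + 4 * E)) / 2 := Real.sq_sqrt (by positivity)
  rw [A, hp]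
  linear_combination -hs / 4

theorem pMinus_mem_Ioo {E : ℝ} (hE : -1 / 4 < E) (hE' : E < 0) : pMinus E ∈ Ioo 0 pstar := by
  have hs : 0 < √(1 + 4 * E) := Real.sqrt_pos.2 (by linarith)
  have hs' : √(1 + 4 * E) < 1 := (Real.sqrt_lt' one_pos).2 (by linarith)
  refine ⟨Real.sqrt_pos.2 (by linarith), (Real.sqrt_lt' pstar_pos).2 ?_⟩
  rw [pstar_sq]
  linarith

theorem A_pMinus {E : ℝ} (hE : -1 / 4 ≤ E) (hE' : E ≤ 0) : A (pMinus E) = -E := by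
  have hs : √(1 + 4 * E) ^ 2 = 1 + 4 * E := Real.sq_sqrt (by linarith)
  have hs' : √(1 + 4 * E) ≤ 1 := Real.sqrt_le_one.2 (by linarith)
  have hp : pMinus E ^ 2 = (1 - √(1 + 4 * E)) / 2 := Real.sq_sqrt (by linarith)
  rw [A, hp]
  linear_combination -hs / 4

/-- For every `p₀ ∈ (0,1)` and `q₀ > 0`, with `E = q₀² − A(p₀)`:
`E > −1/4`; there is a unique `p₊ > p⋆` with `A(p₊) = −E`, and it satisfies `p₊ > p₀`
and `p₊ < 1 ↔ E < 0`; if moreover `E < 0`, there is a unique `p₋ ∈ (0, p⋆)` with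
`A(p₋) = −E`, and then `0 < p₋ < p₀` and `0 < p₋ < p⋆ < p₊ < 1`. -/
theorem turning_points (p₀ q₀ : ℝ) (hp₀ : p₀ ∈ Set.Ioo (0 : ℝ) 1) (hq₀ : 0 < q₀) :
    -1 / 4 < q₀ ^ 2 - A p₀ ∧
    (∃! pp : ℝ, pstar < pp ∧ A pp = -(q₀ ^ 2 - A p₀)) ∧
    (∀ pp : ℝ, pstar < pp → A pp = -(q₀ ^ 2 - A p₀) →
      p₀ < pp ∧ (pp < 1 ↔ q₀ ^ 2 - A p₀ < 0)) ∧
    (q₀ ^ 2 - A p₀ < 0 →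
      (∃! pm : ℝ, pm ∈ Set.Ioo 0 pstar ∧ A pm = -(q₀ ^ 2 - A p₀)) ∧
      (∀ pm pp : ℝ, pm ∈ Set.Ioo 0 pstar → A pm = -(q₀ ^ 2 - A p₀) →
        pstar < pp → A pp = -(q₀ ^ 2 - A p₀) →
        0 < pm ∧ pm < p₀ ∧ pm < pstar ∧ pstar < pp ∧ pp < 1)) := by
  have hq : 0 < q₀ ^ 2 := by positivity
  have hE : -1 / 4 < q₀ ^ 2 - A p₀ := by
    rw [A_eq_sub_sq]
    nlinarith [sq_nonneg (p₀ ^ 2 - 1 / 2)]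
  have lt_one_iff : ∀ pp : ℝ, pstar < pp → A pp = -(q₀ ^ 2 - A p₀) →
      (pp < 1 ↔ q₀ ^ 2 - A p₀ < 0) := by
    intro pp hpp hA
    rw [← strictAntiOn_A.lt_iff_gt (mem_Ici.2 pstar_lt_one.le) (mem_Ici.2 hpp.le), A_one, hA,
      Left.neg_pos_iff]
  refine ⟨hE, ⟨pPlus _, ⟨pstar_lt_pPlus hE, A_pPlus hE.le⟩, ?_⟩, ?_, fun hE' => ⟨?_, ?_⟩⟩
  · rintro y ⟨hy, hAy⟩
    exact strictAntiOn_A.injOn (mem_Ici.2 hy.le) (mem_Ici.2 (pstar_lt_pPlus hE).le)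
      (hAy.trans (A_pPlus hE.le).symm)
  · intro pp hpp hA
    refine ⟨?_, lt_one_iff pp hpp hA⟩
    by_contra! h
    have := strictAntiOn_A.antitoneOn (mem_Ici.2 hpp.le) (mem_Ici.2 (hpp.le.trans h)) h
    linarith
  · refine ⟨pMinus _, ⟨pMinus_mem_Ioo hE hE', A_pMinus hE.le hE'.le⟩, ?_⟩
    rintro y ⟨hy, hAy⟩
    exact strictMonoOn_A.injOn (Ioo_subset_Icc_self hy)
      (Ioo_subset_Icc_self (pMinus_mem_Ioo hE hE')) (hAy.trans (A_pMinus hE.le hE'.le).symm)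
  · intro pm pp hpm hAm hpp hAp
    refine ⟨hpm.1, ?_, hpm.2, hpp, (lt_one_iff pp hpp hAp).2 hE'⟩
    by_contra! h
    have := strictMonoOn_A.monotoneOn ⟨hp₀.1.le, h.trans hpm.2.le⟩ (Ioo_subset_Icc_self hpm) h
    linarith
end

section
/- For every integer N ≥ 1, the function 𝒯 : (0,1) → (0,∞), p₀ ↦ 𝒯(p₀) = T₊(p₀, (1/(2N))√A(p₀)), is continuously differentiable and strictly decreasing on (0,1); that is, 𝒯'(p₀) < 0 for every p₀ ∈ (0,1). -/
open Real MeasureTheory Set Filter Topology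

/-- `𝒯(p₀) = T₊(p₀, (1/(2N))√A(p₀))`. -/
noncomputable def calT (N : ℕ) (p₀ : ℝ) : ℝ :=
  Tplus p₀ (1 / (2 * (N : ℝ)) * Real.sqrt (A p₀))

/-- Continuity of an integral depending on a parameter, with a moving upper endpoint. -/
theorem continuousOn_parametric_primitive {U : Set ℝ} {F : ℝ → ℝ → ℝ} {θ : ℝ → ℝ}
    (hF : ContinuousOn (fun p : ℝ × ℝ => F p.1 p.2) (U ×ˢ univ)) (hθ : ContinuousOn θ U) :
    ContinuousOn (fun x => ∫ t in (0 : ℝ)..θ x, F x t) U := by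
  rw [continuousOn_iff_continuous_domRestrict] at hθ ⊢
  have h1 : Continuous (Function.uncurry fun (x : U) (t : ℝ) => F x t) :=
    hF.comp_continuous (f := fun p : U × ℝ => ((p.1 : ℝ), p.2)) (by fun_prop)
      (fun p => ⟨p.1.2, mem_univ _⟩)
  exact (intervalIntegral.continuous_parametric_primitive_of_continuous (μ := volume)
    (a₀ := 0) h1).comp (continuous_id.prodMk hθ)

/-- Leibniz rule for an integral depending on a parameter, with a fixed interval. -/
theorem hasDerivAt_parametric_intervalIntegral {U : Set ℝ} (hU : IsOpen U) {F F' : ℝ → ℝ → ℝ}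
    (hF : ContinuousOn (fun p : ℝ × ℝ => F p.1 p.2) (U ×ˢ univ))
    (hF' : ContinuousOn (fun p : ℝ × ℝ => F' p.1 p.2) (U ×ˢ univ))
    (hd : ∀ x ∈ U, ∀ t, HasDerivAt (fun x => F x t) (F' x t) x) {x : ℝ} (hx : x ∈ U) (a b : ℝ) :
    HasDerivAt (fun x => ∫ t in a..b, F x t) (∫ t in a..b, F' x t) x := by
  have slice : ∀ {H : ℝ → ℝ → ℝ}, ContinuousOn (fun p : ℝ × ℝ => H p.1 p.2) (U ×ˢ univ) →
      ∀ y ∈ U, Continuous (H y) := fun {H} hH y hy =>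
    hH.comp_continuous (f := fun t : ℝ => (y, t)) (by fun_prop) (fun t => ⟨hy, mem_univ _⟩)
  obtain ⟨r, hr, hrU⟩ := Metric.nhds_basis_closedBall.mem_iff.1 (hU.mem_nhds hx)
  obtain ⟨C, hC⟩ := ((isCompact_closedBall x r).prod (isCompact_uIcc (a := a) (b := b))
    ).exists_bound_of_continuousOn (hF'.mono (prod_mono hrU (subset_univ _)))
  refine (intervalIntegral.hasDerivAt_integral_of_dominated_loc_of_deriv_le
    (bound := fun _ => C) (Metric.closedBall_mem_nhds x hr) ?_
    ((slice hF x hx).intervalIntegrable _ _)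
    (slice hF' x hx).aestronglyMeasurable ?_ intervalIntegrable_const ?_).2
  · filter_upwards [hU.mem_nhds hx] with y hy using (slice hF y hy).aestronglyMeasurable
  · exact Eventually.of_forall fun t ht y hy => hC (y, t) ⟨hy, uIoc_subset_uIcc ht⟩
  · exact Eventually.of_forall fun t _ y hy => hd y (hrU hy) t

/-- Leibniz rule for an integral depending on a parameter, with a moving upper endpoint. -/
theorem hasDerivAt_parametric_primitive {U : Set ℝ} (hU : IsOpen U) {F F' : ℝ → ℝ → ℝ}
    {θ : ℝ → ℝ} {θ' : ℝ}
    (hF : ContinuousOn (fun p : ℝ × ℝ => F p.1 p.2) (U ×ˢ univ))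
    (hF' : ContinuousOn (fun p : ℝ × ℝ => F' p.1 p.2) (U ×ˢ univ))
    (hd : ∀ x ∈ U, ∀ t, HasDerivAt (fun x => F x t) (F' x t) x) {x : ℝ} (hx : x ∈ U)
    (hθ : HasDerivAt θ θ' x) :
    HasDerivAt (fun x => ∫ t in (0 : ℝ)..θ x, F x t)
      ((∫ t in (0 : ℝ)..θ x, F' x t) + F x (θ x) * θ') x := by
  have slice : ∀ y ∈ U, Continuous (F y) := fun y hy =>
    hF.comp_continuous (f := fun t : ℝ => (y, t)) (by fun_prop) (fun t => ⟨hy, mem_univ _⟩)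
  have hUp : U ×ˢ (univ : Set ℝ) ∈ 𝓝 (x, θ x) :=
    (hU.prod isOpen_univ).mem_nhds ⟨hx, mem_univ _⟩
  have hprim : ContinuousOn (fun p : ℝ × ℝ => ∫ t in (0 : ℝ)..p.2, F' p.1 t) (U ×ˢ univ) := by
    have h1 : Continuous (Function.uncurry fun (x : U) (t : ℝ) => F' x t) :=
      hF'.comp_continuous (f := fun p : U × ℝ => ((p.1 : ℝ), p.2)) (by fun_prop)
        (fun p => ⟨p.1.2, mem_univ _⟩)
    have h2 := intervalIntegral.continuous_parametric_primitive_of_continuous (μ := volume)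
      (a₀ := 0) h1
    rw [continuousOn_iff_continuous_domRestrict]
    exact h2.comp (f := fun p : (U ×ˢ (univ : Set ℝ) : Set (ℝ × ℝ)) =>
      ((⟨p.1.1, p.2.1⟩ : U), p.1.2)) (by fun_prop)
  have key := hasStrictFDerivAt_uncurry_coprod (𝕜 := ℝ) (u := (x, θ x))
    (f := fun x b => ∫ t in (0 : ℝ)..b, F x t)
    (f₁ := fun x b => ContinuousLinearMap.toSpanSingleton ℝ (∫ t in (0 : ℝ)..b, F' x t))
    (f₂ := fun x b => ContinuousLinearMap.toSpanSingleton ℝ (F x b))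
    (by
      filter_upwards [hUp] with v hv
      exact (hasDerivAt_parametric_intervalIntegral hU hF hF' hd hv.1 0 v.2).hasFDerivAt)
    (by
      filter_upwards [hUp] with v hv
      exact ((slice v.1 hv.1).integral_hasStrictDerivAt 0 v.2).hasDerivAt.hasFDerivAt)
    (by
      have := hprim.continuousAt hUp
      exact (ContinuousLinearMap.toSpanSingletonCLE (𝕜 := ℝ) (E := ℝ)).continuous.continuousAt.comp
        this)
    (by
      have := hF.continuousAt hUp
      exact (ContinuousLinearMap.toSpanSingletonCLE (𝕜 := ℝ) (E := ℝ)).continuous.continuousAt.comp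
        this)
  have := key.hasFDerivAt.comp_hasDerivAt x ((hasDerivAt_id x).prodMk hθ)
  refine HasDerivAt.congr_deriv this ?_
  simp [Function.HasUncurry.uncurry, mul_comm]

/-- The amplitude `σ` with `u² = (1 + σ cos θ)/2` along the orbit through `u² = (1 + y)/2`. -/
noncomputable def amplitude (e y : ℝ) : ℝ := √(e ^ 2 + (1 - e ^ 2) * y ^ 2)

/-- The angle `Θ` with `cos Θ = y / σ`. -/
noncomputable def endAngle (e y : ℝ) : ℝ := arccos (y / amplitude e y)

/-- The period function (up to a factor `√2`) in the angular variable. -/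
noncomputable def anglePeriod (e y : ℝ) : ℝ :=
  ∫ t in (0 : ℝ)..endAngle e y, 1 / √(1 + amplitude e y * cos t)

section

variable {e y : ℝ}

theorem amplitude_radicand_pos (he0 : 0 < e) (he1 : e < 1) (y : ℝ) :
    0 < e ^ 2 + (1 - e ^ 2) * y ^ 2 := by
  have : 0 ≤ (1 - e ^ 2) * y ^ 2 := mul_nonneg (by nlinarith) (sq_nonneg y)
  positivity

theorem amplitude_pos (he0 : 0 < e) (he1 : e < 1) (y : ℝ) : 0 < amplitude e y :=
  sqrt_pos.2 (amplitude_radicand_pos he0 he1 y)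

theorem sq_amplitude (he0 : 0 < e) (he1 : e < 1) (y : ℝ) :
    amplitude e y ^ 2 = e ^ 2 + (1 - e ^ 2) * y ^ 2 :=
  sq_sqrt (amplitude_radicand_pos he0 he1 y).le

theorem amplitude_lt_one (he0 : 0 < e) (he1 : e < 1) (hy : y ∈ Ioo (-1 : ℝ) 1) :
    amplitude e y < 1 := by
  have h1 := sq_amplitude he0 he1 y
  have h2 : 0 < (1 - e ^ 2) * (1 - y ^ 2) :=
    mul_pos (by nlinarith) (by nlinarith [hy.1, hy.2])
  have := amplitude_pos he0 he1 y
  nlinarith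

theorem one_add_amplitude_mul_cos_pos (he0 : 0 < e) (he1 : e < 1) (hy : y ∈ Ioo (-1 : ℝ) 1)
    (t : ℝ) : 0 < 1 + amplitude e y * cos t := by
  have := amplitude_pos he0 he1 y
  have := amplitude_lt_one he0 he1 hy
  nlinarith [neg_one_le_cos t]

theorem continuous_amplitude (e : ℝ) : Continuous (amplitude e) := by
  unfold amplitude
  fun_prop

theorem hasDerivAt_amplitude (he0 : 0 < e) (he1 : e < 1) (y : ℝ) :
    HasDerivAt (amplitude e) ((1 - e ^ 2) * y / amplitude e y) y := by
  have h : HasDerivAt (fun y : ℝ => e ^ 2 + (1 - e ^ 2) * y ^ 2) ((1 - e ^ 2) * (2 * y)) y := by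
    simpa using ((hasDerivAt_pow 2 y).const_mul (1 - e ^ 2)).const_add (e ^ 2)
  refine (h.sqrt (amplitude_radicand_pos he0 he1 y).ne').congr_deriv ?_
  have := amplitude_pos he0 he1 y
  change _ / (2 * amplitude e y) = _
  field_simp

theorem one_sub_div_amplitude_sq (he0 : 0 < e) (he1 : e < 1) (hy : y ∈ Ioo (-1 : ℝ) 1) :
    √(1 - (y / amplitude e y) ^ 2) = e * √(1 - y ^ 2) / amplitude e y := by
  have hs := amplitude_pos he0 he1 y
  have hy2 : 0 ≤ 1 - y ^ 2 := by nlinarith [hy.1, hy.2]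
  have h : 1 - (y / amplitude e y) ^ 2 = (e * √(1 - y ^ 2) / amplitude e y) ^ 2 := by
    rw [div_pow, div_pow, mul_pow, sq_sqrt hy2]
    field_simp
    rw [sq_amplitude he0 he1]
    ring
  rw [h, sqrt_sq (by positivity)]

theorem div_amplitude_mem (he0 : 0 < e) (he1 : e < 1) (hy : y ∈ Ioo (-1 : ℝ) 1) :
    y / amplitude e y ∈ Ioo (-1 : ℝ) 1 := by
  have hs := amplitude_pos he0 he1 y
  have h2 : y ^ 2 < amplitude e y ^ 2 := by
    rw [sq_amplitude he0 he1]
    have : 0 < e ^ 2 * (1 - y ^ 2) := mul_pos (by positivity) (by nlinarith [hy.1, hy.2])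
    nlinarith
  have := abs_lt_of_sq_lt_sq' h2 hs.le
  constructor
  · rw [lt_div_iff₀ hs]; linarith [this.1]
  · rw [div_lt_one hs]; exact this.2

theorem cos_endAngle (he0 : 0 < e) (he1 : e < 1) (hy : y ∈ Ioo (-1 : ℝ) 1) :
    cos (endAngle e y) = y / amplitude e y := by
  have := div_amplitude_mem he0 he1 hy
  exact cos_arccos this.1.le this.2.le

theorem amplitude_mul_cos_endAngle (he0 : 0 < e) (he1 : e < 1) (hy : y ∈ Ioo (-1 : ℝ) 1) :
    amplitude e y * cos (endAngle e y) = y := by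
  rw [cos_endAngle he0 he1 hy, mul_div_cancel₀ _ (amplitude_pos he0 he1 y).ne']

theorem sin_endAngle (he0 : 0 < e) (he1 : e < 1) (hy : y ∈ Ioo (-1 : ℝ) 1) :
    sin (endAngle e y) = e * √(1 - y ^ 2) / amplitude e y := by
  rw [endAngle, sin_arccos, one_sub_div_amplitude_sq he0 he1 hy]

theorem hasDerivAt_endAngle (he0 : 0 < e) (he1 : e < 1) (hy : y ∈ Ioo (-1 : ℝ) 1) :
    HasDerivAt (endAngle e) (-(e / (amplitude e y ^ 2 * √(1 - y ^ 2)))) y := by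
  have hs := amplitude_pos he0 he1 y
  have hm := div_amplitude_mem he0 he1 hy
  have hr : 0 < √(1 - y ^ 2) := sqrt_pos.2 (by nlinarith [hy.1, hy.2])
  have h := (hasDerivAt_arccos hm.1.ne' hm.2.ne).comp y
    ((hasDerivAt_id y).div (hasDerivAt_amplitude he0 he1 y) hs.ne')
  refine h.congr_deriv ?_
  simp only [id]
  rw [one_sub_div_amplitude_sq he0 he1 hy]
  have h2 : 1 * amplitude e y - y * ((1 - e ^ 2) * y / amplitude e y) = e ^ 2 / amplitude e y := by
    field_simp
    rw [sq_amplitude he0 he1]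
    ring
  rw [h2]
  field_simp

/-- The derivative in `y` of the integrand of `anglePeriod`. -/
noncomputable def integrandDeriv (e y t : ℝ) : ℝ :=
  -((1 - e ^ 2) * y / (2 * amplitude e y)) * (cos t / √(1 + amplitude e y * cos t) ^ 3)

theorem hasDerivAt_integrand (he0 : 0 < e) (he1 : e < 1) (hy : y ∈ Ioo (-1 : ℝ) 1) (t : ℝ) :
    HasDerivAt (fun y => 1 / √(1 + amplitude e y * cos t)) (integrandDeriv e y t) y := by
  have hp := one_add_amplitude_mul_cos_pos he0 he1 hy t
  have hq : 0 < √(1 + amplitude e y * cos t) := sqrt_pos.2 hp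
  have hs := amplitude_pos he0 he1 y
  have h := ((((hasDerivAt_amplitude he0 he1 y).mul_const (cos t)).const_add 1).sqrt hp.ne').inv
    hq.ne'
  simp only [one_div]
  refine h.congr_deriv ?_
  unfold integrandDeriv
  field_simp

theorem continuousOn_integrand (he0 : 0 < e) (he1 : e < 1) :
    ContinuousOn (fun p : ℝ × ℝ => 1 / √(1 + amplitude e p.1 * cos p.2))
      (Ioo (-1 : ℝ) 1 ×ˢ univ) := by
  have := continuous_amplitude e
  exact continuousOn_const.div (by fun_prop) fun p hp =>
    (sqrt_pos.2 (one_add_amplitude_mul_cos_pos he0 he1 hp.1 p.2)).ne'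

theorem continuousOn_integrandDeriv (he0 : 0 < e) (he1 : e < 1) :
    ContinuousOn (fun p : ℝ × ℝ => integrandDeriv e p.1 p.2) (Ioo (-1 : ℝ) 1 ×ˢ univ) := by
  have := continuous_amplitude e
  unfold integrandDeriv
  refine ContinuousOn.mul (ContinuousOn.neg (ContinuousOn.div (by fun_prop) (by fun_prop) ?_))
    (ContinuousOn.div (by fun_prop) (by fun_prop) ?_)
  · exact fun p _ => (mul_pos two_pos (amplitude_pos he0 he1 p.1)).ne'
  · exact fun p hp => (pow_pos (sqrt_pos.2 (one_add_amplitude_mul_cos_pos he0 he1 hp.1 p.2)) 3).ne'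

/-- The derivative of `anglePeriod`. -/
noncomputable def anglePeriodDeriv (e y : ℝ) : ℝ :=
  (∫ t in (0 : ℝ)..endAngle e y, integrandDeriv e y t) +
    1 / √(1 + y) * -(e / (amplitude e y ^ 2 * √(1 - y ^ 2)))

theorem hasDerivAt_anglePeriod (he0 : 0 < e) (he1 : e < 1) (hy : y ∈ Ioo (-1 : ℝ) 1) :
    HasDerivAt (anglePeriod e) (anglePeriodDeriv e y) y := by
  have := hasDerivAt_parametric_primitive isOpen_Ioo
    (F := fun y t => 1 / √(1 + amplitude e y * cos t))
    (continuousOn_integrand he0 he1) (continuousOn_integrandDeriv he0 he1)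
    (fun y hy t => hasDerivAt_integrand he0 he1 hy t) hy (hasDerivAt_endAngle he0 he1 hy)
  simp only [amplitude_mul_cos_endAngle he0 he1 hy] at this
  exact this

theorem continuousOn_anglePeriodDeriv (he0 : 0 < e) (he1 : e < 1) :
    ContinuousOn (anglePeriodDeriv e) (Ioo (-1 : ℝ) 1) := by
  have := continuous_amplitude e
  refine (continuousOn_parametric_primitive (continuousOn_integrandDeriv he0 he1) fun y hy =>
    (hasDerivAt_endAngle he0 he1 hy).continuousAt.continuousWithinAt).add
    ((ContinuousOn.div (by fun_prop) (by fun_prop) ?_).mul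
      (ContinuousOn.neg (ContinuousOn.div (by fun_prop) (by fun_prop) ?_)))
  · exact fun y hy => (sqrt_pos.2 (by linarith [hy.1])).ne'
  · exact fun y hy => (mul_pos (pow_pos (amplitude_pos he0 he1 y) 2)
      (sqrt_pos.2 (by nlinarith [hy.1, hy.2]))).ne'

theorem cos_div_sqrt_pow_three_le {s c : ℝ} (hs : 0 ≤ s) (h : 0 < 1 + s * c) :
    c / √(1 + s * c) ^ 3 ≤ c := by
  have hq : 0 < √(1 + s * c) := sqrt_pos.2 h
  rw [div_le_iff₀ (pow_pos hq 3)]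
  rcases le_total 0 c with hc | hc
  · have : 1 ≤ √(1 + s * c) := one_le_sqrt.2 (by nlinarith)
    exact le_mul_of_one_le_right hc (one_le_pow₀ this)
  · have : √(1 + s * c) ≤ 1 := sqrt_le_one.2 (by nlinarith)
    have := pow_le_one₀ (n := 3) hq.le this
    nlinarith

theorem anglePeriodDeriv_neg (he0 : 0 < e) (he1 : e < 1) (hy : y ∈ Ioo (-1 : ℝ) 1) :
    anglePeriodDeriv e y < 0 := by
  have hs := amplitude_pos he0 he1 y
  have hp := one_add_amplitude_mul_cos_pos he0 he1 hy
  have hr : 0 < √(1 - y ^ 2) := sqrt_pos.2 (by nlinarith [hy.1, hy.2])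
  have hr2 : √(1 - y ^ 2) ^ 2 = 1 - y ^ 2 := sq_sqrt (by nlinarith [hy.1, hy.2])
  have hw : 0 < √(1 + y) := sqrt_pos.2 (by linarith [hy.1])
  have he2 : 0 < 1 - e ^ 2 := by nlinarith
  have hΘ : 0 ≤ endAngle e y := arccos_nonneg _
  have hboundary : 0 < 1 / √(1 + y) * (e / (amplitude e y ^ 2 * √(1 - y ^ 2))) := by positivity
  have hcont : Continuous fun t => cos t / √(1 + amplitude e y * cos t) ^ 3 :=
    Continuous.div (by fun_prop) (by fun_prop) fun t => (pow_pos (sqrt_pos.2 (hp t)) 3).ne'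
  unfold anglePeriodDeriv integrandDeriv
  rw [intervalIntegral.integral_const_mul]
  set J := ∫ t in (0 : ℝ)..endAngle e y, cos t / √(1 + amplitude e y * cos t) ^ 3
  rcases le_or_gt 0 y with h0 | h0
  · have hJ0 : 0 ≤ J := by
      refine intervalIntegral.integral_nonneg hΘ fun t ht => ?_
      have : endAngle e y ≤ π / 2 := arccos_le_pi_div_two.2 (by positivity)
      have := cos_nonneg_of_mem_Icc (x := t) ⟨by linarith [ht.1, pi_pos], by linarith [ht.2]⟩
      positivity
    have : 0 ≤ (1 - e ^ 2) * y / (2 * amplitude e y) * J := by positivity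
    linarith
  · have hJ1 : J ≤ e * √(1 - y ^ 2) / amplitude e y := by
      rw [← sin_endAngle he0 he1 hy, ← sub_zero (sin (endAngle e y)), ← sin_zero, ← integral_cos]
      exact intervalIntegral.integral_mono_on hΘ (hcont.intervalIntegrable _ _)
        (continuous_cos.intervalIntegrable _ _)
        fun t _ => cos_div_sqrt_pow_three_le hs.le (hp t)
    have hc : 0 ≤ -((1 - e ^ 2) * y / (2 * amplitude e y)) := by
      rw [← neg_div, ← mul_neg]
      have : 0 ≤ -y := by linarith
      positivity
    have h1 := mul_le_mul_of_nonneg_left hJ1 hc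
    have h2 : -((1 - e ^ 2) * y / (2 * amplitude e y)) * (e * √(1 - y ^ 2) / amplitude e y) <
        1 / √(1 + y) * (e / (amplitude e y ^ 2 * √(1 - y ^ 2))) := by
      have hw1 : √(1 + y) ≤ 1 := sqrt_le_one.2 (by linarith)
      have hz : (1 - e ^ 2) * -y * (1 - y ^ 2) * √(1 + y) < 2 := by
        have a1 : (1 - e ^ 2) * -y ≤ 1 := by nlinarith [hy.1]
        have a2 : (1 - e ^ 2) * -y * (1 - y ^ 2) ≤ 1 :=
          mul_le_one₀ a1 (by nlinarith [hy.1]) (by nlinarith)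
        have a3 := mul_le_one₀ a2 hw.le hw1
        linarith
      have e1 : -((1 - e ^ 2) * y / (2 * amplitude e y)) * (e * √(1 - y ^ 2) / amplitude e y) =
          (1 - e ^ 2) * -y * (1 - y ^ 2) * √(1 + y) *
            (e / (2 * amplitude e y ^ 2 * √(1 - y ^ 2) * √(1 + y))) := by
        field_simp
        rw [hr2]
      have e2 : 1 / √(1 + y) * (e / (amplitude e y ^ 2 * √(1 - y ^ 2))) =
          2 * (e / (2 * amplitude e y ^ 2 * √(1 - y ^ 2) * √(1 + y))) := by
        field_simp
      rw [e1, e2]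
      exact mul_lt_mul_of_pos_right hz (by positivity)
    linarith

end

/-- The period function in the angular variable, via `u² = (1 + σ cos θ)/2`. -/
theorem calT_eq_anglePeriod {N : ℕ} (hN : 1 ≤ N) {p : ℝ} (hp : p ∈ Ioo (0 : ℝ) 1) :
    calT N p = (√2)⁻¹ * anglePeriod (1 / (2 * N)) (2 * p ^ 2 - 1) := by
  have hN' : (1 : ℝ) ≤ N := by exact_mod_cast hN
  have he0 : (0 : ℝ) < 1 / (2 * N) := by positivity
  have he1 : (1 : ℝ) / (2 * N) < 1 := by rw [div_lt_one (by positivity)]; linarith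
  unfold calT
  generalize (1 : ℝ) / (2 * N) = e at he0 he1
  have hy : 2 * p ^ 2 - 1 ∈ Ioo (-1 : ℝ) 1 :=
    ⟨by nlinarith [hp.1], by nlinarith [hp.1, hp.2]⟩
  have hA : 0 < A p := mul_pos (pow_pos hp.1 2) (by nlinarith [hp.1, hp.2])
  have hs := amplitude_pos he0 he1 (2 * p ^ 2 - 1)
  have hs2 := sq_amplitude he0 he1 (2 * p ^ 2 - 1)
  have hpos := one_add_amplitude_mul_cos_pos he0 he1 hy
  have hend := amplitude_mul_cos_endAngle he0 he1 hy
  have hE : (e * √(A p)) ^ 2 - A p = (amplitude e (2 * p ^ 2 - 1) ^ 2 - 1) / 4 := by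
    rw [mul_pow, sq_sqrt hA.le, hs2]
    unfold A
    ring
  unfold Tplus anglePeriod
  rw [hE]
  have hΘ0 : 0 ≤ endAngle e (2 * p ^ 2 - 1) := arccos_nonneg _
  have hΘπ : endAngle e (2 * p ^ 2 - 1) ≤ π := arccos_le_pi _
  generalize amplitude e (2 * p ^ 2 - 1) = s at *
  generalize endAngle e (2 * p ^ 2 - 1) = Θ at *
  have hplus : pPlus ((s ^ 2 - 1) / 4) = √((1 + s * cos 0) / 2) := by
    rw [pPlus, cos_zero, mul_one, show 1 + 4 * ((s ^ 2 - 1) / 4) = s ^ 2 by ring, sqrt_sq hs.le]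
  have hminus : p = √((1 + s * cos Θ) / 2) := by
    rw [hend, show (1 + (2 * p ^ 2 - 1)) / 2 = p ^ 2 by ring, sqrt_sq hp.1.le]
  have hle : p ≤ √((1 + s * cos 0) / 2) := by
    nth_rewrite 1 [hminus]
    apply sqrt_le_sqrt
    have := cos_le_one Θ
    rw [cos_zero]
    nlinarith
  have hder : ∀ t, HasDerivAt (fun t => √((1 + s * cos t) / 2))
      (s * -sin t / 2 / (2 * √((1 + s * cos t) / 2))) t := fun t =>
    ((((hasDerivAt_cos t).const_mul s).const_add 1).div_const 2).sqrt (half_pos (hpos t)).ne'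
  have hsin : ∀ t ∈ Ioo 0 Θ, 0 < sin t := fun t ht =>
    sin_pos_of_pos_of_lt_pi ht.1 (ht.2.trans_le hΘπ)
  have key := integral_Icc_deriv_smul_of_deriv_nonpos
    (g := fun u => 1 / √((s ^ 2 - 1) / 4 + A u))
    (fun t _ => (hder t).continuousAt.continuousWithinAt) (fun t _ => hder t)
    (fun t ht => by
      have := hsin t ht
      rw [mul_neg, neg_div, neg_div]
      exact neg_nonpos.2 (by positivity)) hΘ0
  rw [← hminus] at key
  rw [hplus, intervalIntegral.integral_of_le hle, ← integral_Icc_eq_integral_Ioc,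
    ← neg_eq_iff_eq_neg.2 key, intervalIntegral.integral_of_le hΘ0,
    ← integral_const_mul, ← integral_neg, integral_Icc_eq_integral_Ioo,
    integral_Ioc_eq_integral_Ioo]
  refine setIntegral_congr_fun measurableSet_Ioo fun t ht => ?_
  have hst := hsin t ht
  have hX := hpos t
  have hq : 0 < √(1 + s * cos t) := sqrt_pos.2 hX
  have hroot : √((s ^ 2 - 1) / 4 + A √((1 + s * cos t) / 2)) = s * sin t / 2 := by
    rw [A, sq_sqrt (half_pos hX).le, 
      show (s ^ 2 - 1) / 4 + (1 + s * cos t) / 2 * (1 - (1 + s * cos t) / 2) =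
        (s * sin t / 2) ^ 2 by linear_combination -s ^ 2 / 4 * sin_sq_add_cos_sq t,
      sqrt_sq (by positivity)]
  have h2 : √2 * √2 = 2 := mul_self_sqrt zero_le_two
  simp only [hroot, smul_eq_mul]
  rw [sqrt_div hX.le]
  field_simp
  linear_combination h2

/-- for every integer `N ≥ 1`, `𝒯` is `C¹` and strictly decreasing on `(0,1)`,
with `𝒯'(p₀) < 0` for every `p₀ ∈ (0,1)`. -/
theorem calT_strictly_decreasing (N : ℕ) (hN : 1 ≤ N) :
    ContDiffOn ℝ 1 (calT N) (Set.Ioo 0 1) ∧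
    StrictAntiOn (calT N) (Set.Ioo 0 1) ∧
    ∀ p₀ ∈ Set.Ioo (0 : ℝ) 1, deriv (calT N) p₀ < 0 := by
  have hN' : (1 : ℝ) ≤ N := by exact_mod_cast hN
  have he0 : (0 : ℝ) < 1 / (2 * N) := by positivity
  have he1 : (1 : ℝ) / (2 * N) < 1 := by rw [div_lt_one (by positivity)]; linarith
  have hmaps : MapsTo (fun p : ℝ => 2 * p ^ 2 - 1) (Ioo 0 1) (Ioo (-1) 1) := fun p hp =>
    ⟨by nlinarith [hp.1], by nlinarith [hp.1, hp.2]⟩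
  have hder : ∀ p ∈ Ioo (0 : ℝ) 1, HasDerivAt (calT N)
      ((√2)⁻¹ * (anglePeriodDeriv (1 / (2 * N)) (2 * p ^ 2 - 1) * (4 * p))) p := by
    intro p hp
    have h1 : HasDerivAt (fun p : ℝ => 2 * p ^ 2 - 1) (4 * p) p := by
      refine (((hasDerivAt_pow 2 p).const_mul 2).sub_const 1).congr_deriv ?_
      norm_num
      ring
    have h2 := ((hasDerivAt_anglePeriod he0 he1 (hmaps hp)).comp p h1).const_mul (√2)⁻¹
    refine h2.congr_of_eventuallyEq ?_
    filter_upwards [isOpen_Ioo.mem_nhds hp] with q hq using calT_eq_anglePeriod hN hq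
  have hneg : ∀ p ∈ Ioo (0 : ℝ) 1, deriv (calT N) p < 0 := by
    intro p hp
    rw [(hder p hp).deriv]
    exact mul_neg_of_pos_of_neg (by positivity)
      (mul_neg_of_neg_of_pos (anglePeriodDeriv_neg he0 he1 (hmaps hp)) (by linarith [hp.1]))
  have hcont : ContinuousOn (calT N) (Ioo 0 1) := fun p hp =>
    (hder p hp).continuousAt.continuousWithinAt
  refine ⟨?_, strictAntiOn_of_deriv_neg (convex_Ioo 0 1) hcont (by rwa [interior_Ioo]), hneg⟩
  rw [contDiffOn_one_iff_derivWithin isOpen_Ioo.uniqueDiffOn]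
  refine ⟨fun p hp => (hder p hp).differentiableAt.differentiableWithinAt, ?_⟩
  refine ContinuousOn.congr (f := fun p => (√2)⁻¹ *
    (anglePeriodDeriv (1 / (2 * N)) (2 * p ^ 2 - 1) * (4 * p))) ?_ fun p hp => ?_
  · exact continuousOn_const.mul (((continuousOn_anglePeriodDeriv he0 he1).comp
      (by fun_prop) hmaps).mul (by fun_prop))
  · rw [derivWithin_of_isOpen isOpen_Ioo hp, (hder p hp).deriv]
end

section
/- For every integer N ≥ 1, the integral ℬ(p₀) = ∫_{p₀}^{p₊} u² du/√(E₀(p₀) + A(u)) satisfies ℬ(p₀) → 0 as p₀ → 1⁻ and ℬ(p₀) → 1 as p₀ → 0⁺; consequently the mass-to-ε ratio 2N ℬ(p₀) + 1 − √(1 − p₀²) tends to 1 as p₀ → 1⁻ and tends to 2N as p₀ → 0⁺. -/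
open Real MeasureTheory Set Filter Topology

/-- The energy level `E₀(p₀) = −(1 − 1/(4N²)) A(p₀)`. -/
noncomputable def Ezero (N : ℕ) (p₀ : ℝ) : ℝ := -(1 - 1 / (4 * (N : ℝ) ^ 2)) * A p₀

/-- `ℬ(p₀) = ∫_{p₀}^{p₊} u² du/√(E₀(p₀) + A(u))`. -/
noncomputable def calB (N : ℕ) (p₀ : ℝ) : ℝ :=
  ∫ u in p₀..pPlus (Ezero N p₀), u ^ 2 / Real.sqrt (Ezero N p₀ + A u)

open intervalIntegral in
/-- A continuous function with a nonnegative derivative on the open interval has an integrable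
derivative, whose integral is the increment. -/
theorem intervalIntegrable_and_integral_eq_sub_of_nonneg {f g : ℝ → ℝ} {s t : ℝ} (hst : s ≤ t)
    (hc : ContinuousOn f (Icc s t)) (hd : ∀ u ∈ Ioo s t, HasDerivAt f (g u) u)
    (hg : ∀ u ∈ Ioo s t, 0 ≤ g u) :
    IntervalIntegrable g volume s t ∧ ∫ u in s..t, g u = f t - f s := by
  have hi : IntervalIntegrable g volume s t := by
    apply intervalIntegrable_deriv_of_nonneg (g := f)
    · rwa [uIcc_of_le hst]
    · simpa [hst] using hd
    · simpa [hst] using hg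
  exact ⟨hi, integral_eq_sub_of_hasDerivAt_of_le hst hc hd hi⟩

theorem hasDerivAt_neg_sqrt_sub_sq {a u : ℝ} (h : u ^ 2 < a) :
    HasDerivAt (fun u => -√(a - u ^ 2)) (u / √(a - u ^ 2)) u := by
  have h0 : a - u ^ 2 ≠ 0 := by linarith
  have h1 : √(a - u ^ 2) ≠ 0 := (sqrt_pos.2 (by linarith)).ne'
  refine (((hasDerivAt_pow 2 u).const_sub a).sqrt h0).neg.congr_deriv ?_
  field_simp
  norm_num

theorem hasDerivAt_arcsin_sq {a b u : ℝ} (hb : b < u ^ 2) (ha : u ^ 2 < a) :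
    HasDerivAt (fun u => arcsin ((2 * u ^ 2 - a - b) / (a - b)) / 2)
      (u / √((a - u ^ 2) * (u ^ 2 - b))) u := by
  have hab : 0 < a - b := by linarith
  have hpos : 0 < (a - u ^ 2) * (u ^ 2 - b) := mul_pos (by linarith) (by linarith)
  have hs : √(1 - ((2 * u ^ 2 - a - b) / (a - b)) ^ 2) =
      2 * √((a - u ^ 2) * (u ^ 2 - b)) / (a - b) := by
    rw [sqrt_eq_iff_mul_self_eq_of_pos (by positivity)]
    field_simp
    rw [sq_sqrt hpos.le]
    ring
  have h1 : (2 * u ^ 2 - a - b) / (a - b) ≠ -1 := by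
    intro h
    rw [div_eq_iff hab.ne'] at h
    linarith
  have h2 : (2 * u ^ 2 - a - b) / (a - b) ≠ 1 := by
    intro h
    rw [div_eq_iff hab.ne'] at h
    linarith
  have hin : HasDerivAt (fun u : ℝ => (2 * u ^ 2 - a - b) / (a - b)) (4 * u / (a - b)) u := by
    refine (((((hasDerivAt_pow 2 u).const_mul 2).sub_const a).sub_const b).div_const
      (a - b)).congr_deriv ?_
    ring
  have h0 : √((a - u ^ 2) * (u ^ 2 - b)) ≠ 0 := (sqrt_pos.2 hpos).ne'
  refine (((hasDerivAt_arcsin h1 h2).comp u hin).div_const 2).congr_deriv ?_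
  rw [hs]
  field_simp
  ring

theorem integral_sq_div_sqrt_mem_Icc {a b s : ℝ} (hs : 0 < s) (hb : 0 ≤ b) (hbs : b < s ^ 2)
    (hsa : s ^ 2 < a) :
    ∫ u in s..√a, u ^ 2 / √((a - u ^ 2) * (u ^ 2 - b)) ∈
      Icc √(a - s ^ 2) (√(a - s ^ 2) + √b * (π / 2)) := by
  have ha : 0 < a := (sq_nonneg s).trans_lt hsa
  have hst : s ≤ √a := le_sqrt_of_sq_le hsa.le
  have hmem : ∀ u ∈ Ioo s √a, 0 < u ∧ b < u ^ 2 ∧ u ^ 2 < a := fun u hu =>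
    ⟨hs.trans hu.1, hbs.trans (pow_lt_pow_left₀ hu.1 hs.le two_ne_zero),
      (lt_sqrt (hs.trans hu.1).le).1 hu.2⟩
  obtain ⟨hi₁, he₁⟩ := intervalIntegrable_and_integral_eq_sub_of_nonneg hst
    (f := fun u => -√(a - u ^ 2)) (g := fun u => u / √(a - u ^ 2)) (by fun_prop)
    (fun u hu => hasDerivAt_neg_sqrt_sub_sq (hmem u hu).2.2)
    (fun u hu => div_nonneg (hmem u hu).1.le (sqrt_nonneg _))
  obtain ⟨hi₂, he₂⟩ := intervalIntegrable_and_integral_eq_sub_of_nonneg hst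
    (f := fun u => arcsin ((2 * u ^ 2 - a - b) / (a - b)) / 2)
    (g := fun u => u / √((a - u ^ 2) * (u ^ 2 - b)))
    (Continuous.continuousOn ((continuous_arcsin.comp (by fun_prop)).div_const 2))
    (fun u hu => hasDerivAt_arcsin_sq (hmem u hu).2.1 (hmem u hu).2.2)
    (fun u hu => div_nonneg (hmem u hu).1.le (sqrt_nonneg _))
  have hle : ∀ u ∈ Ioo s √a, u ^ 2 / √((a - u ^ 2) * (u ^ 2 - b)) ≤
      u / √(a - u ^ 2) + √b * (u / √((a - u ^ 2) * (u ^ 2 - b))) := by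
    intro u hu
    obtain ⟨hu0, hbu, hua⟩ := hmem u hu
    have h1 : 0 < √(a - u ^ 2) := sqrt_pos.2 (by linarith)
    have h2 : 0 < √(u ^ 2 - b) := sqrt_pos.2 (by linarith)
    have h3 : u ≤ √(u ^ 2 - b) + √b := by
      refine (sq_le_sq₀ hu0.le (by positivity)).1 ?_
      nlinarith [sq_sqrt (sub_nonneg.2 hbu.le), sq_sqrt hb, mul_nonneg h2.le (sqrt_nonneg b)]
    rw [sqrt_mul (by linarith)]
    calc u ^ 2 / (√(a - u ^ 2) * √(u ^ 2 - b))
        ≤ u * (√(u ^ 2 - b) + √b) / (√(a - u ^ 2) * √(u ^ 2 - b)) := by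
          gcongr
          nlinarith
      _ = _ := by field_simp
  have hge : ∀ u ∈ Ioo s √a, u / √(a - u ^ 2) ≤ u ^ 2 / √((a - u ^ 2) * (u ^ 2 - b)) := by
    intro u hu
    obtain ⟨hu0, hbu, hua⟩ := hmem u hu
    have h1 : 0 < √(a - u ^ 2) := sqrt_pos.2 (by linarith)
    have h2 : 0 < √(u ^ 2 - b) := sqrt_pos.2 (by linarith)
    have h3 : √(u ^ 2 - b) ≤ u := sqrt_le_iff.2 ⟨hu0.le, by linarith⟩
    rw [sqrt_mul (by linarith), div_le_div_iff₀ h1 (by positivity)]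
    calc u * (√(a - u ^ 2) * √(u ^ 2 - b)) ≤ u * (√(a - u ^ 2) * u) := by gcongr
      _ = _ := by ring
  have hi : IntervalIntegrable (fun u => u ^ 2 / √((a - u ^ 2) * (u ^ 2 - b))) volume s √a := by
    have hmul := hi₂.continuousOn_mul (g := fun u => u) (by fun_prop)
    refine hmul.congr fun u _ => ?_
    ring
  have hlower := intervalIntegral.integral_mono_on_of_le_Ioo hst hi₁ hi hge
  have hupper := intervalIntegral.integral_mono_on_of_le_Ioo hst hi
    (hi₁.add (hi₂.const_mul √b)) hle
  rw [intervalIntegral.integral_add hi₁ (hi₂.const_mul √b), intervalIntegral.integral_const_mul,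
    he₁, he₂] at hupper
  rw [he₁] at hlower
  simp only [sq_sqrt ha.le, sub_self, sqrt_zero, neg_zero, zero_sub, neg_neg] at hlower hupper
  refine ⟨hlower, hupper.trans ?_⟩
  gcongr
  linarith [arcsin_le_pi_div_two ((2 * a - a - b) / (a - b)),
    neg_pi_div_two_le_arcsin ((2 * s ^ 2 - a - b) / (a - b))]

theorem calB_mem_Icc {N : ℕ} (hN : 1 ≤ N) {p : ℝ} (hp : p ∈ Ioo (0 : ℝ) 1) :
    calB N p ∈ Icc √(pPlus (Ezero N p) ^ 2 - p ^ 2)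
      (√(pPlus (Ezero N p) ^ 2 - p ^ 2) + pMinus (Ezero N p) * (π / 2)) := by
  obtain ⟨hp0, hp1⟩ := hp
  have hN' : (1 : ℝ) ≤ (N : ℝ) ^ 2 := one_le_pow₀ (by exact_mod_cast hN)
  obtain ⟨c, hc⟩ : ∃ c : ℝ, c = 1 / (4 * (N : ℝ) ^ 2) := ⟨_, rfl⟩
  have hc0 : 0 < c := by rw [hc]; positivity
  have hc1 : c < 1 := by rw [hc, div_lt_one (by positivity)]; linarith
  have hA0 : 0 < A p := mul_pos (by positivity) (by nlinarith)
  have hA1 : A p ≤ 1 / 4 := by unfold A; nlinarith [sq_nonneg (p ^ 2 - 1 / 2)]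
  have hE : Ezero N p = -(1 - c) * A p := by rw [Ezero, hc]
  unfold calB
  generalize Ezero N p = E at *
  have hE0 : E < 0 := by rw [hE]; nlinarith
  have hE1 : 0 < 1 + 4 * E := by rw [hE]; nlinarith
  have hEA : 0 < E + A p := by rw [hE]; nlinarith
  set r := √(1 + 4 * E) with hr
  have hr0 : 0 < r := sqrt_pos.2 hE1
  have hr2 : r ^ 2 = 1 + 4 * E := sq_sqrt hE1.le
  have hr1 : r < 1 := by nlinarith
  have hfac : ∀ u, E + A u = ((1 + r) / 2 - u ^ 2) * (u ^ 2 - (1 - r) / 2) := by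
    intro u
    unfold A
    linear_combination -hr2 / 4
  rw [hfac] at hEA
  have hbs : (1 - r) / 2 < p ^ 2 := by
    by_contra! h
    nlinarith
  have hsa : p ^ 2 < (1 + r) / 2 := by
    by_contra! h
    nlinarith
  have := integral_sq_div_sqrt_mem_Icc hp0 (by linarith) hbs hsa
  simp only [hfac, pPlus, pMinus, ← hr]
  rwa [sq_sqrt (by linarith)]

theorem tendsto_calB {N : ℕ} (hN : 1 ≤ N) {l : Filter ℝ} {x : ℝ} (hl : l ≤ 𝓝 x)
    (hmem : ∀ᶠ p in l, p ∈ Ioo (0 : ℝ) 1) (hx : A x = 0) :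
    Tendsto (calB N) l (𝓝 √(1 - x ^ 2)) := by
  have hE : Continuous (Ezero N) := by
    unfold Ezero A
    fun_prop
  have hEx : Ezero N x = 0 := by simp [Ezero, hx]
  have hlow : Continuous fun p => √(pPlus (Ezero N p) ^ 2 - p ^ 2) := by
    unfold pPlus
    fun_prop
  have hup : Continuous fun p =>
      √(pPlus (Ezero N p) ^ 2 - p ^ 2) + pMinus (Ezero N p) * (π / 2) := by
    refine hlow.add ?_
    unfold pMinus
    fun_prop
  refine tendsto_of_tendsto_of_tendsto_of_le_of_le' ?_ ?_
    (hmem.mono fun p hp => (calB_mem_Icc hN hp).1) (hmem.mono fun p hp => (calB_mem_Icc hN hp).2)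
  · convert (hlow.tendsto x).mono_left hl using 2
    simp [hEx, pPlus]
  · convert (hup.tendsto x).mono_left hl using 2
    simp [hEx, pPlus, pMinus]

/-- for every integer `N ≥ 1`, `ℬ(p₀) → 0` as `p₀ → 1⁻`, `ℬ(p₀) → 1` as
`p₀ → 0⁺`; consequently `2N ℬ(p₀) + 1 − √(1 − p₀²) → 1` as `p₀ → 1⁻` and `→ 2N` as `p₀ → 0⁺`. -/
theorem calB_limits (N : ℕ) (hN : 1 ≤ N) :
    Tendsto (calB N) (nhdsWithin 1 (Set.Iio 1)) (nhds 0) ∧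
    Tendsto (calB N) (nhdsWithin 0 (Set.Ioi 0)) (nhds 1) ∧
    Tendsto (fun p₀ => 2 * (N : ℝ) * calB N p₀ + 1 - Real.sqrt (1 - p₀ ^ 2))
      (nhdsWithin 1 (Set.Iio 1)) (nhds 1) ∧
    Tendsto (fun p₀ => 2 * (N : ℝ) * calB N p₀ + 1 - Real.sqrt (1 - p₀ ^ 2))
      (nhdsWithin 0 (Set.Ioi 0)) (nhds (2 * (N : ℝ))) := by
  have h1 : Tendsto (calB N) (𝓝[<] 1) (𝓝 0) := by
    simpa using tendsto_calB hN nhdsWithin_le_nhds (Ioo_mem_nhdsLT one_pos)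
      (show A 1 = 0 by simp [A])
  have h0 : Tendsto (calB N) (𝓝[>] 0) (𝓝 1) := by
    simpa using tendsto_calB hN nhdsWithin_le_nhds (Ioo_mem_nhdsGT one_pos)
      (show A 0 = 0 by simp [A])
  have hs : Continuous fun p : ℝ => √(1 - p ^ 2) := by fun_prop
  refine ⟨h1, h0, ?_, ?_⟩
  · simpa using ((h1.const_mul (2 * (N : ℝ))).add_const 1).sub
      ((hs.tendsto 1).mono_left nhdsWithin_le_nhds)
  · simpa using ((h0.const_mul (2 * (N : ℝ))).add_const 1).sub
      ((hs.tendsto 0).mono_left nhdsWithin_le_nhds)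
end

section
/- For every constant C > 0, the period function satisfies T₊(p₀, C√A(p₀)) → ∞ as p₀ → 0⁺. -/
open Real MeasureTheory Set Filter Topology

lemma half_le_pPlus_sq (E : ℝ) : 1 / 2 ≤ pPlus E ^ 2 := by
  have h := Real.sqrt_nonneg (1 + 4 * E)
  rw [pPlus, Real.sq_sqrt (by positivity)]
  linarith

lemma half_le_pPlus (E : ℝ) : 1 / 2 ≤ pPlus E := by
  refine Real.le_sqrt_of_sq_le ?_
  have h := Real.sqrt_nonneg (1 + 4 * E)
  linarith

lemma add_A_eq_mul {E : ℝ} (hE : 0 ≤ 1 + 4 * E) (u : ℝ) :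
    E + A u = (pPlus E ^ 2 - u ^ 2) * (u ^ 2 + pPlus E ^ 2 - 1) := by
  have h := Real.sqrt_nonneg (1 + 4 * E)
  rw [pPlus, Real.sq_sqrt (by positivity), A]
  linear_combination (-1 / 4) * Real.sq_sqrt hE

/-- The integrand of `Tplus` is integrable: its singularity at `pPlus E` is at most of inverse
square root type. -/
lemma intervalIntegrable_one_div_sqrt_add_A {E p : ℝ} (hp0 : 0 < p) (hp : p < 1 / 2)
    (hpos : 0 < E + A p) :
    IntervalIntegrable (fun u => 1 / √(E + A u)) volume p (pPlus E) := by
  have hE : 0 ≤ 1 + 4 * E := by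
    rw [A] at hpos
    nlinarith [sq_nonneg (1 - 2 * p ^ 2)]
  have hr := half_le_pPlus E
  have hr2 := half_le_pPlus_sq E
  have hfac := add_A_eq_mul hE
  set r := pPlus E
  have hm : 0 < p ^ 2 + r ^ 2 - 1 := by
    refine pos_of_mul_pos_right (a := r ^ 2 - p ^ 2) ?_ (by nlinarith)
    rw [← hfac]
    exact hpos
  set m := p ^ 2 + r ^ 2 - 1
  have hfi : IntervalIntegrable (fun u => (1 / √(m * r)) * (r - u) ^ (-(1 / 2) : ℝ))
      volume p r := by
    refine IntervalIntegrable.const_mul ?_ _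
    simpa using (intervalIntegral.intervalIntegrable_rpow' (a := r - p) (b := 0)
      (r := -(1 / 2)) (by norm_num)).comp_sub_left r
  refine hfi.mono_fun ?_ ?_
  · refine Measurable.aestronglyMeasurable ?_
    unfold A
    fun_prop
  · rw [uIoc_of_le (by linarith)]
    filter_upwards [ae_restrict_mem measurableSet_Ioc] with u hu
    obtain ⟨hpu, hur⟩ := hu
    have hru : 0 ≤ r - u := by linarith
    rw [Real.norm_of_nonneg (by positivity), Real.norm_of_nonneg (by positivity)]
    rcases hur.eq_or_lt with rfl | hlt
    · simp [hfac]
    · have hru' : 0 < r - u := by linarith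
      rw [Real.rpow_neg hru, ← Real.sqrt_eq_rpow, ← one_div, one_div_mul_one_div,
        ← Real.sqrt_mul (by positivity)]
      refine one_div_le_one_div_of_le (Real.sqrt_pos.2 (by positivity)) (Real.sqrt_le_sqrt ?_)
      calc m * r * (r - u) = (r - u) * r * m := by ring
        _ ≤ (r ^ 2 - u ^ 2) * (u ^ 2 + r ^ 2 - 1) := by
          refine mul_le_mul ?_ ?_ hm.le ?_ <;> nlinarith
        _ = E + A u := (hfac u).symm

lemma log_div_le_Tplus {C p : ℝ} (hC : 0 < C) (hp0 : 0 < p) (hp : p < 1 / 2) :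
    1 / √(C ^ 2 + 1) * log (1 / 2 / p) ≤ Tplus p (C * √(A p)) := by
  have hA : 0 < A p := by
    have : 0 < 1 - p ^ 2 := by nlinarith
    unfold A
    positivity
  have hq : (C * √(A p)) ^ 2 = C ^ 2 * A p := by rw [mul_pow, Real.sq_sqrt hA.le]
  rw [Tplus, hq]
  set E := C ^ 2 * A p - A p with hEdef
  have hfi : IntervalIntegrable (fun u => 1 / √(E + A u)) volume p (pPlus E) :=
    intervalIntegrable_one_div_sqrt_add_A hp0 hp (by
      have : 0 < C ^ 2 * A p := by positivity
      linarith)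
  have hr := half_le_pPlus E
  calc 1 / √(C ^ 2 + 1) * log (1 / 2 / p)
      = ∫ u in p..1 / 2, 1 / √(C ^ 2 + 1) * (1 / u) := by
        rw [intervalIntegral.integral_const_mul, integral_one_div_of_pos hp0 (by norm_num)]
    _ ≤ ∫ u in p..1 / 2, 1 / √(E + A u) := by
        refine intervalIntegral.integral_mono_on hp.le ?_ ?_ fun u ⟨hpu, hu⟩ => ?_
        · refine (intervalIntegral.intervalIntegrable_one_div (fun u hu => ?_)
            continuousOn_id).const_mul _
          rw [uIcc_of_le hp.le] at hu
          exact (hp0.trans_le hu.1).ne'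
        · refine hfi.mono_set ?_
          rw [uIcc_of_le hp.le, uIcc_of_le (by linarith)]
          exact Icc_subset_Icc_right hr
        · have hu0 : 0 < u := hp0.trans_le hpu
          have hmono : A p ≤ A u := by
            have h1 : 0 ≤ u ^ 2 - p ^ 2 := by nlinarith
            have h2 : 0 ≤ 1 - u ^ 2 - p ^ 2 := by nlinarith
            unfold A
            linear_combination mul_nonneg h1 h2
          have hup : A u ≤ u ^ 2 := by
            unfold A
            nlinarith [sq_nonneg (u ^ 2)]
          have hC2 : 0 < C ^ 2 * A p := by positivity
          have hCle : C ^ 2 * A p ≤ C ^ 2 * u ^ 2 :=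
            mul_le_mul_of_nonneg_left (hmono.trans hup) (sq_nonneg C)
          rw [one_div_mul_one_div]
          refine one_div_le_one_div_of_le (Real.sqrt_pos.2 (by linarith)) ?_
          refine Real.sqrt_le_iff.2 ⟨by positivity, ?_⟩
          rw [mul_pow, Real.sq_sqrt (by positivity)]
          linarith
    _ ≤ ∫ u in p..pPlus E, 1 / √(E + A u) :=
        intervalIntegral.integral_mono_interval le_rfl hp.le hr
          (Eventually.of_forall fun u => by positivity) hfi

/-- for every constant `C > 0`, `T₊(p₀, C√A(p₀)) → ∞` as `p₀ → 0⁺`. -/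
theorem Tplus_diverges_along_C_curve (C : ℝ) (hC : 0 < C) :
    Tendsto (fun p₀ => Tplus p₀ (C * Real.sqrt (A p₀)))
      (nhdsWithin 0 (Set.Ioi 0)) atTop := by
  have hlog : Tendsto (fun p : ℝ => 1 / √(C ^ 2 + 1) * log (1 / 2 / p))
      (𝓝[>] 0) atTop := by
    refine Tendsto.const_mul_atTop (by positivity) (tendsto_log_atTop.comp ?_)
    exact (tendsto_inv_nhdsGT_zero.const_mul_atTop one_half_pos).congr
      fun p => (div_eq_mul_inv (1 / 2) p).symm
  refine tendsto_atTop_mono' _ ?_ hlog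
  filter_upwards [Ioo_mem_nhdsGT (by norm_num : (0 : ℝ) < 1 / 2)] with p hp
  exact log_div_le_Tplus hC hp.1 hp.2
end

section
/- For every fixed p₀ ∈ (0, p_*], the function q₀ ↦ T₊(p₀, q₀) is strictly decreasing on (0, ∞); that is, its partial derivative ∂T₊/∂q₀(p₀,q₀) is negative for every q₀ ∈ (0,∞). -/
open Real MeasureTheory Set Filter Topology

/-- Differentiation under the integral sign for integrands `1 / √(α + x β)`. -/
theorem hasDerivAt_integral_one_div_sqrt {α β : ℝ → ℝ} {a b x₀ : ℝ} (hab : a ≤ b)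
    (hα : Continuous α) (hβ : Continuous β) (hβ₀ : ∀ t ∈ Icc a b, 0 ≤ β t)
    (hpos : ∀ t ∈ Icc a b, ∀ x > 0, 0 < α t + x * β t) (hx₀ : 0 < x₀) :
    IntervalIntegrable (fun t => β t / (2 * √(α t + x₀ * β t) ^ 3)) volume a b ∧
    HasDerivAt (fun x => ∫ t in a..b, 1 / √(α t + x * β t))
      (-∫ t in a..b, β t / (2 * √(α t + x₀ * β t) ^ 3)) x₀ := by
  have hcont : ∀ x > 0, ContinuousOn (fun t => 1 / √(α t + x * β t)) (Icc a b) := fun x hx =>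
    ContinuousOn.div (by fun_prop) (by fun_prop) fun t ht =>
      (Real.sqrt_pos.2 (hpos t ht x hx)).ne'
  have hcont' : ∀ x > 0, ContinuousOn (fun t => β t / (2 * √(α t + x * β t) ^ 3)) (Icc a b) :=
    fun x hx => ContinuousOn.div (by fun_prop) (by fun_prop) fun t ht => by
      have := Real.sqrt_pos.2 (hpos t ht x hx)
      positivity
  have hsub : uIoc a b ⊆ Icc a b := by
    rw [uIoc_of_le hab]; exact Ioc_subset_Icc_self
  have hint : ∀ x > 0,
      IntervalIntegrable (fun t => β t / (2 * √(α t + x * β t) ^ 3)) volume a b := fun x hx =>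
    ContinuousOn.intervalIntegrable_of_Icc hab (hcont' x hx)
  refine ⟨hint x₀ hx₀, ?_⟩
  rw [← intervalIntegral.integral_neg]
  refine (intervalIntegral.hasDerivAt_integral_of_dominated_loc_of_deriv_le
    (F := fun x t => 1 / √(α t + x * β t))
    (F' := fun x t => -(β t / (2 * √(α t + x * β t) ^ 3)))
    (bound := fun t => β t / (2 * √(α t + x₀ / 2 * β t) ^ 3))
    (s := Ioi (x₀ / 2)) (Ioi_mem_nhds (by linarith)) ?_ ?_ ?_ ?_ (hint _ (by positivity)) ?_).2
  · filter_upwards [Ioi_mem_nhds hx₀] with x hx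
    exact ((hcont x hx).mono hsub).aestronglyMeasurable measurableSet_uIoc
  · exact ContinuousOn.intervalIntegrable_of_Icc hab (hcont x₀ hx₀)
  · exact ((hcont' x₀ hx₀).neg.mono hsub).aestronglyMeasurable measurableSet_uIoc
  · refine ae_of_all _ fun t ht x hx => ?_
    have hβt := hβ₀ t (hsub ht)
    have hs := Real.sqrt_pos.2 (hpos t (hsub ht) (x₀ / 2) (by positivity))
    rw [norm_neg, Real.norm_of_nonneg (by positivity)]
    have hx : x₀ / 2 ≤ x := le_of_lt hx
    gcongr
  · refine ae_of_all _ fun t ht x hx => ?_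
    have hx : 0 < x := lt_trans (by positivity) (mem_Ioi.1 hx)
    have hp := hpos t (hsub ht) x hx
    have hs := Real.sqrt_pos.2 hp
    have hlin : HasDerivAt (fun x => α t + x * β t) (β t) x := by
      simpa using ((hasDerivAt_id x).mul_const (β t)).const_add (α t)
    have h := (hasDerivAt_const x (1 : ℝ)).div (hlin.sqrt hp.ne') hs.ne'
    convert! h using 1
    field_simp
    ring

theorem pPlus_eq_sqrt {r : ℝ} (hr : 0 ≤ r) : pPlus (r ^ 2 - 1 / 4) = √(1 / 2 + r) := by
  rw [pPlus, show 1 + 4 * (r ^ 2 - 1 / 4) = (2 * r) ^ 2 by ring, Real.sqrt_sq (by positivity)]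
  ring_nf

/-- The substitution `u² = 1/2 + r sin θ` removes the singularity at the turning point `p₊`. -/
theorem integral_pstar_pPlus {r : ℝ} (hr : 0 < r) :
    IntervalIntegrable (fun u => 1 / √((r ^ 2 - 1 / 4) + A u)) volume
      pstar (pPlus (r ^ 2 - 1 / 4)) ∧
    ∫ u in pstar..pPlus (r ^ 2 - 1 / 4), 1 / √((r ^ 2 - 1 / 4) + A u) =
      2⁻¹ * ∫ θ in (0 : ℝ)..π / 2, 1 / √(1 / 2 + r * sin θ) := by
  have hsin : ∀ θ ∈ Icc 0 (π / 2), 0 < 1 / 2 + r * sin θ := fun θ hθ => by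
    have := sin_nonneg_of_nonneg_of_le_pi hθ.1 (by linarith [hθ.2, pi_pos])
    positivity
  have hcos : ∀ θ ∈ Ioo 0 (π / 2), 0 < cos θ := fun θ hθ =>
    cos_pos_of_mem_Ioo ⟨by linarith [hθ.1, pi_pos], hθ.2⟩
  let f : ℝ → ℝ := fun θ => √(1 / 2 + r * sin θ)
  let f' : ℝ → ℝ := fun θ => r * cos θ / (2 * √(1 / 2 + r * sin θ))
  let g : ℝ → ℝ := fun u => 1 / √((r ^ 2 - 1 / 4) + A u)
  have hf : ContinuousOn f (Icc 0 (π / 2)) := by fun_prop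
  have hff' : ∀ θ ∈ Ioo 0 (π / 2), HasDerivAt f (f' θ) θ := fun θ hθ =>
    (((hasDerivAt_sin θ).const_mul r).const_add (1 / 2)).sqrt
      (hsin θ (Ioo_subset_Icc_self hθ)).ne'
  have hf' : ∀ θ ∈ Ioo 0 (π / 2), 0 ≤ f' θ := fun θ hθ => by
    have := hcos θ hθ
    positivity
  have hf0 : f 0 = pstar := by simp [f, pstar]
  have hf1 : f (π / 2) = pPlus (r ^ 2 - 1 / 4) := by
    rw [pPlus_eq_sqrt hr.le]; simp [f]
  have hle : pstar ≤ pPlus (r ^ 2 - 1 / 4) := by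
    rw [← hf0, ← hf1]
    exact Real.sqrt_le_sqrt (by simp [hr.le])
  have hcongr : EqOn (fun θ => f' θ • g (f θ)) (fun θ => 2⁻¹ * (1 / √(1 / 2 + r * sin θ)))
      (Ioo 0 (π / 2)) := fun θ hθ => by
    have hw := hsin θ (Ioo_subset_Icc_self hθ)
    have hc := hcos θ hθ
    have hs := Real.sqrt_pos.2 hw
    have hE : (r ^ 2 - 1 / 4) + A (f θ) = (r * cos θ) ^ 2 := by
      simp only [A, f]
      rw [Real.sq_sqrt hw.le]
      linear_combination (-r ^ 2) * sin_sq_add_cos_sq θ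
    simp only [f', g, smul_eq_mul]
    rw [hE, Real.sqrt_sq (by positivity)]
    field_simp
  have hcont : ContinuousOn (fun θ => 2⁻¹ * (1 / √(1 / 2 + r * sin θ))) (Icc 0 (π / 2)) :=
    ContinuousOn.mul (by fun_prop) (ContinuousOn.div (by fun_prop) (by fun_prop)
      fun θ hθ => (Real.sqrt_pos.2 (hsin θ hθ)).ne')
  have hpi : (0 : ℝ) ≤ π / 2 := by positivity
  constructor
  · rw [intervalIntegrable_iff_integrableOn_Icc_of_le hle, ← hf0, ← hf1,
      ← integrableOn_Icc_deriv_smul_iff_of_deriv_nonneg hf hff' hf' hpi,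
      integrableOn_Icc_iff_integrableOn_Ioo, integrableOn_congr_fun hcongr measurableSet_Ioo,
      ← integrableOn_Icc_iff_integrableOn_Ioo]
    exact hcont.integrableOn_Icc
  · rw [intervalIntegral.integral_of_le hle, ← integral_Icc_eq_integral_Ioc, ← hf0, ← hf1,
      ← integral_Icc_deriv_smul_of_deriv_nonneg hf hff' hf' hpi,
      integral_Icc_eq_integral_Ioo, setIntegral_congr_fun measurableSet_Ioo hcongr,
      ← intervalIntegral.integral_const_mul, intervalIntegral.integral_of_le hpi,
      integral_Ioc_eq_integral_Ioo]

theorem A_le_A_of_le_pstar {p u : ℝ} (hp : 0 < p) (hu : u ∈ Icc p pstar) : A p ≤ A u := by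
  have h1 : p ^ 2 ≤ u ^ 2 := pow_le_pow_left₀ hp.le hu.1 2
  have h2 : u ^ 2 ≤ 1 / 2 := pstar_sq ▸ pow_le_pow_left₀ (hp.le.trans hu.1) hu.2 2
  unfold A
  nlinarith

theorem continuous_A : Continuous A := by unfold A; fun_prop

/-- Splitting `T₊` at `p⋆` makes both pieces integrals over intervals independent of `q`. -/
theorem Tplus_eq {p q : ℝ} (hp : p ∈ Ioc 0 pstar) (hq : 0 < q) :
    Tplus p q = (∫ u in p..pstar, 1 / √((A u - A p) + q ^ 2 * 1)) +
      2⁻¹ * ∫ θ in (0 : ℝ)..π / 2, 1 / √(1 / 2 + √(q ^ 2 + (p ^ 2 - 1 / 2) ^ 2) * sin θ) := by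
  set r := √(q ^ 2 + (p ^ 2 - 1 / 2) ^ 2) with hr
  have hr0 : 0 < r := Real.sqrt_pos.2 (by positivity)
  have hE : q ^ 2 - A p = r ^ 2 - 1 / 4 := by
    rw [hr, Real.sq_sqrt (by positivity), A]; ring
  have hint : IntervalIntegrable (fun u => 1 / √((r ^ 2 - 1 / 4) + A u)) volume p pstar := by
    refine ContinuousOn.intervalIntegrable_of_Icc hp.2 (ContinuousOn.div (by fun_prop)
      (continuous_const.add continuous_A).sqrt.continuousOn fun u hu => ?_)
    have := A_le_A_of_le_pstar hp.1 hu
    rw [← hE]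
    exact (Real.sqrt_pos.2 (by nlinarith)).ne'
  obtain ⟨hint', heq⟩ := integral_pstar_pPlus hr0
  rw [Tplus, hE, ← intervalIntegral.integral_add_adjacent_intervals hint hint', heq, ← hE]
  congr 3
  ext u
  ring_nf

theorem deriv_Tplus_neg {p q : ℝ} (hp : p ∈ Ioc 0 pstar) (hq : 0 < q) :
    deriv (fun q => Tplus p q) q < 0 := by
  have hsin : ∀ θ ∈ Icc 0 (π / 2), 0 ≤ sin θ := fun θ hθ =>
    sin_nonneg_of_nonneg_of_le_pi hθ.1 (by linarith [hθ.2, pi_pos])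
  have hr0 : 0 < √(q ^ 2 + (p ^ 2 - 1 / 2) ^ 2) := Real.sqrt_pos.2 (by positivity)
  have hpi : (0 : ℝ) < π / 2 := by positivity
  have h1 := (hasDerivAt_integral_one_div_sqrt (α := fun u => A u - A p) (β := fun _ => 1) hp.2
    (continuous_A.sub continuous_const) continuous_const (fun _ _ => zero_le_one)
    (fun u hu x hx => by linarith [A_le_A_of_le_pstar hp.1 hu]) (pow_pos hq 2)).2
  obtain ⟨hint, h2⟩ := hasDerivAt_integral_one_div_sqrt (α := fun _ => 1 / 2) (β := sin) hpi.le
    continuous_const continuous_sin hsin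
    (fun θ hθ x hx => by have := hsin θ hθ; positivity) hr0
  have hsq : HasDerivAt (fun q : ℝ => q ^ 2) (2 * q) q := by simpa using hasDerivAt_pow 2 q
  have hr := (hsq.add_const ((p ^ 2 - 1 / 2) ^ 2)).sqrt (by positivity)
  have hT := (HasDerivAt.comp (h := fun q : ℝ => q ^ 2) q h1 hsq).add
    ((HasDerivAt.comp (h := fun q : ℝ => √(q ^ 2 + (p ^ 2 - 1 / 2) ^ 2)) q h2 hr).const_mul 2⁻¹)
  rw [(hT.congr_of_eventuallyEq
    (eventually_of_mem (Ioi_mem_nhds hq) fun x hx => Tplus_eq hp hx)).deriv]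
  have hI1 : 0 ≤ ∫ u in p..pstar, 1 / (2 * √(A u - A p + q ^ 2 * 1) ^ 3) :=
    intervalIntegral.integral_nonneg hp.2 fun u _ => by positivity
  have hI2 := intervalIntegral.intervalIntegral_pos_of_pos_on hint (fun θ hθ => by
    have hs : 0 < sin θ := sin_pos_of_pos_of_lt_pi hθ.1 (by linarith [hθ.2])
    positivity) hpi
  have hprod := mul_nonneg hI1 (by positivity : 0 ≤ 2 * q)
  have hprod' := mul_pos hI2
    (by positivity : 0 < 2 * q / (2 * √(q ^ 2 + (p ^ 2 - 1 / 2) ^ 2)))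
  linarith

/-- for every fixed `p₀ ∈ (0, p⋆]`, `q₀ ↦ T₊(p₀,q₀)` is strictly decreasing on
`(0,∞)`, with negative partial derivative there. -/
theorem Tplus_strictly_decreasing_in_q (p₀ : ℝ) (hp₀ : p₀ ∈ Set.Ioc 0 pstar) :
    StrictAntiOn (fun q₀ => Tplus p₀ q₀) (Set.Ioi 0) ∧
    ∀ q₀ ∈ Set.Ioi (0 : ℝ), deriv (fun q => Tplus p₀ q) q₀ < 0 := by
  have hderiv : ∀ q ∈ Ioi (0 : ℝ), deriv (fun q => Tplus p₀ q) q < 0 := fun q hq =>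
    deriv_Tplus_neg hp₀ hq
  refine ⟨strictAntiOn_of_deriv_neg (convex_Ioi 0) (fun q hq => ?_) (by simpa using hderiv),
    hderiv⟩
  exact (differentiableAt_of_deriv_ne_zero (hderiv q hq).ne).continuousAt.continuousWithinAt
end

section
/- For every p₀ ∈ (0,1) and q₀ > 0, the period function T₊(p₀,·) is differentiable at q₀ and its partial derivative satisfies the identity ((E + 1/4)/(2q₀)) · ∂T₊/∂q₀(p₀,q₀) = ∫_{p₀}^{p₊} (1 − 2u²)/(8u²√(E + A(u))) du − (1 − 2p₀²)/(8p₀q₀), where E = q₀² − A(p₀). -/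
open Real MeasureTheory Set Filter Topology

theorem sqrt_mul_sin_arctan_div (c : ℝ) {q : ℝ} (hq : 0 < q) :
    √(q ^ 2 + c ^ 2) * sin (arctan (c / q)) = c := by
  have h : √(1 + (c / q) ^ 2) = √(q ^ 2 + c ^ 2) / q := by
    rw [← sqrt_sq hq.le, ← sqrt_div' _ (by positivity), sqrt_sq hq.le]
    congr 1
    field_simp
  have : 0 < √(q ^ 2 + c ^ 2) := sqrt_pos.2 (by positivity)
  rw [sin_arctan, h]
  field_simp

theorem sq_le_half_add_sqrt_mul_sin {p q θ : ℝ} (hq : 0 < q)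
    (hθ : θ ∈ Icc (arctan ((p ^ 2 - 1 / 2) / q)) (π / 2)) :
    p ^ 2 ≤ 1 / 2 + √(q ^ 2 + (p ^ 2 - 1 / 2) ^ 2) * sin θ := by
  have h := sqrt_mul_sin_arctan_div (p ^ 2 - 1 / 2) hq
  have hs := sin_le_sin_of_le_of_le_pi_div_two (neg_pi_div_two_lt_arctan _).le hθ.2 hθ.1
  have := mul_le_mul_of_nonneg_left hs (sqrt_nonneg (q ^ 2 + (p ^ 2 - 1 / 2) ^ 2))
  linarith

/-- Leibniz rule with a differentiable lower limit of integration. -/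
theorem hasDerivAt_integral_of_lower_limit {F : ℝ → ℝ → ℝ} {α : ℝ → ℝ} {x₀ α' b F' : ℝ}
    (hF : ContinuousAt (Function.uncurry F) (x₀, α x₀)) (hα : HasDerivAt α α' x₀)
    (hFi : ∀ᶠ x in 𝓝 x₀, IntervalIntegrable (F x) volume (α x) b)
    (hFi₀ : ∀ᶠ x in 𝓝 x₀, IntervalIntegrable (F x) volume (α x₀) b)
    (hF' : HasDerivAt (fun x => ∫ t in α x₀..b, F x t) F' x₀) :
    HasDerivAt (fun x => ∫ t in α x..b, F x t) (F' - α' * F x₀ (α x₀)) x₀ := by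
  have key : HasDerivAt (fun x => ∫ t in α x₀..α x, F x t) (α' * F x₀ (α x₀)) x₀ := by
    have hlin : HasDerivAt (fun x => (α x - α x₀) * F x₀ (α x₀)) (α' * F x₀ (α x₀)) x₀ :=
      (hα.sub_const _).mul_const _
    have hrem : HasDerivAt
        (fun x => (∫ t in α x₀..α x, F x t) - (α x - α x₀) * F x₀ (α x₀)) 0 x₀ := by
      rw [hasDerivAt_iff_isLittleO]
      simp only [intervalIntegral.integral_same, sub_self, zero_mul, smul_zero, sub_zero]
      refine Asymptotics.IsLittleO.trans_isBigO ?_ hα.isBigO_sub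
      rw [Asymptotics.isLittleO_iff]
      intro ε hε
      obtain ⟨δ, hδ, hball⟩ := Metric.continuousAt_iff.1 hF ε hε
      filter_upwards [hFi, hFi₀, Metric.ball_mem_nhds x₀ hδ,
        hα.continuousAt (Metric.ball_mem_nhds _ hδ)] with x h1 h2 hx hαx
      have hi : IntervalIntegrable (F x) volume (α x₀) (α x) := h2.trans h1.symm
      have hsub : (∫ t in α x₀..α x, F x t) - (α x - α x₀) * F x₀ (α x₀) =
          ∫ t in α x₀..α x, (F x t - F x₀ (α x₀)) := by
        rw [intervalIntegral.integral_sub hi intervalIntegrable_const]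
        simp
      rw [hsub]
      refine intervalIntegral.norm_integral_le_of_norm_le_const fun t ht => ?_
      have ht' : dist t (α x₀) < δ := by
        refine lt_of_le_of_lt ?_ hαx
        rw [Real.dist_eq, Real.dist_eq]
        exact abs_sub_left_of_mem_uIcc (uIoc_subset_uIcc ht)
      have := hball (x := (x, t)) (by simpa [Prod.dist_eq] using ⟨hx, ht'⟩)
      simpa [Real.dist_eq] using this.le
    rw [← zero_add (α' * F x₀ (α x₀))]
    exact (hrem.add hlin).congr_of_eventuallyEq (.of_forall fun x => by simp)
  refine (hF'.sub key).congr_of_eventuallyEq ?_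
  filter_upwards [hFi, hFi₀] with x h1 h2
  simp only [Pi.sub_apply]
  rw [intervalIntegral.integral_interval_sub_left h2 (h2.trans h1.symm)]

/-- In the variable `θ` with `u² - 1/2 = R sin θ`, the integrals along the level set
`E + A u ≥ 0` are integrals over `[arctan ((p² - 1/2) / q), π/2]`. -/
theorem integral_div_sqrt_energy (h : ℝ → ℝ) {p q : ℝ} (hp : 0 < p) (hq : 0 < q) :
    ∫ u in p..pPlus (q ^ 2 - A p), h u / √((q ^ 2 - A p) + A u) =
      ∫ θ in arctan ((p ^ 2 - 1 / 2) / q)..π / 2,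
        h √(1 / 2 + √(q ^ 2 + (p ^ 2 - 1 / 2) ^ 2) * sin θ) /
          (2 * √(1 / 2 + √(q ^ 2 + (p ^ 2 - 1 / 2) ^ 2) * sin θ)) := by
  set R := √(q ^ 2 + (p ^ 2 - 1 / 2) ^ 2) with hR
  set a := arctan ((p ^ 2 - 1 / 2) / q) with ha
  have hR2 : R ^ 2 = q ^ 2 + (p ^ 2 - 1 / 2) ^ 2 := sq_sqrt (by positivity)
  have hR0 : 0 < R := sqrt_pos.2 (by positivity)
  have hfa : √(1 / 2 + R * sin a) = p := by
    rw [hR, ha, sqrt_mul_sin_arctan_div _ hq, add_sub_cancel, sqrt_sq hp.le]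
  have hfb : √(1 / 2 + R * sin (π / 2)) = pPlus (q ^ 2 - A p) := by
    have : 1 + 4 * (q ^ 2 - A p) = (2 * R) ^ 2 := by
      rw [mul_pow, hR2, A]; ring
    rw [pPlus, this, sqrt_sq (by positivity), sin_pi_div_two]
    congr 1; ring
  have hab : a < π / 2 := arctan_lt_pi_div_two _
  have hw : ∀ θ ∈ Icc a (π / 2), 0 < 1 / 2 + R * sin θ := fun θ hθ =>
    (by positivity : 0 < p ^ 2).trans_le (sq_le_half_add_sqrt_mul_sin hq hθ)
  have hE : ∀ u, q ^ 2 - A p + A u = R ^ 2 - (u ^ 2 - 1 / 2) ^ 2 := fun u => by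
    rw [hR2, A, A]; ring
  have hsub := intervalIntegral.integral_comp_mul_deriv_of_deriv_nonneg (a := a) (b := π / 2)
    (f := fun θ => √(1 / 2 + R * sin θ)) (f' := fun θ => R * cos θ / (2 * √(1 / 2 + R * sin θ)))
    (g := fun u => h u / √((q ^ 2 - A p) + A u)) (by fun_prop)
    (fun θ hθ => by
      rw [min_eq_left hab.le, max_eq_right hab.le] at hθ
      exact (((hasDerivAt_sin θ).const_mul R).const_add _).sqrt
        (hw θ (Ioo_subset_Icc_self hθ)).ne')
    (fun θ hθ => by
      rw [min_eq_left hab.le, max_eq_right hab.le] at hθ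
      have := cos_pos_of_mem_Ioo ⟨(neg_pi_div_two_lt_arctan _).trans hθ.1, hθ.2⟩
      positivity)
  simp only [hfa, hfb] at hsub
  rw [← hsub]
  refine intervalIntegral.integral_congr_Ioo_of_le hab.le fun θ hθ => ?_
  have hwθ := hw θ (Ioo_subset_Icc_self hθ)
  have hcos := cos_pos_of_mem_Ioo ⟨(neg_pi_div_two_lt_arctan _).trans hθ.1, hθ.2⟩
  have hsqrt : √(q ^ 2 - A p + A √(1 / 2 + R * sin θ)) = R * cos θ := by
    rw [hE, sq_sqrt hwθ.le, ← sqrt_sq (by positivity : 0 ≤ R * cos θ)]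
    congr 1
    linear_combination -R ^ 2 * sin_sq_add_cos_sq θ
  have := sqrt_pos.2 hwθ
  simp only [Function.comp_apply, hsqrt]
  field_simp

theorem hasDerivAt_integral_one_div_sqrt_s8 {a b R m : ℝ} (hm : 0 < m)
    (hw : ∀ θ ∈ uIcc a b, m ≤ 1 / 2 + R * sin θ) :
    HasDerivAt (fun r => ∫ θ in a..b, 1 / (2 * √(1 / 2 + r * sin θ)))
      (∫ θ in a..b, -sin θ / (4 * √(1 / 2 + R * sin θ) ^ 3)) R := by
  have hball : ∀ θ ∈ uIcc a b, ∀ r ∈ Metric.ball R (m / 2), m / 2 ≤ 1 / 2 + r * sin θ := by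
    intro θ hθ r hr
    rw [Metric.mem_ball, Real.dist_eq] at hr
    have h1 : |(r - R) * sin θ| ≤ m / 2 := by
      rw [abs_mul]
      nlinarith [abs_sin_le_one θ, abs_nonneg (r - R), abs_nonneg (sin θ)]
    linarith [neg_abs_le ((r - R) * sin θ), hw θ hθ]
  have hm2 : 0 < √(m / 2) := sqrt_pos.2 (by positivity)
  refine (intervalIntegral.hasDerivAt_integral_of_dominated_loc_of_deriv_le
    (F := fun r θ => 1 / (2 * √(1 / 2 + r * sin θ)))
    (F' := fun r θ => -sin θ / (4 * √(1 / 2 + r * sin θ) ^ 3))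
    (bound := fun _ => 1 / (4 * √(m / 2) ^ 3))
    (Metric.ball_mem_nhds R (half_pos hm))
    (.of_forall fun r => Measurable.aestronglyMeasurable (by fun_prop)) ?_
    (Measurable.aestronglyMeasurable (by fun_prop))
    (.of_forall fun θ hθ r hr => ?_) intervalIntegrable_const
    (.of_forall fun θ hθ r hr => ?_)).2
  · refine ContinuousOn.intervalIntegrable fun θ hθ => ?_
    have := sqrt_pos.2 (hm.trans_le (hw θ hθ))
    exact ContinuousAt.continuousWithinAt (by fun_prop (disch := positivity))
  · have h1 := sqrt_le_sqrt (hball θ (uIoc_subset_uIcc hθ) r hr)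
    have h2 : 0 < √(1 / 2 + r * sin θ) := hm2.trans_le h1
    rw [norm_div, norm_neg, Real.norm_eq_abs, Real.norm_of_nonneg (by positivity)]
    gcongr
    exact abs_sin_le_one θ
  · have hpos := (half_pos hm).trans_le (hball θ (uIoc_subset_uIcc hθ) r hr)
    have h2 := sqrt_pos.2 hpos
    have hd : HasDerivAt (fun r => 2 * √(1 / 2 + r * sin θ))
        (2 * (sin θ / (2 * √(1 / 2 + r * sin θ)))) r := by
      simpa using ((((hasDerivAt_id r).mul_const (sin θ)).const_add (1 / 2)).sqrt
        hpos.ne').const_mul 2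
    refine ((hasDerivAt_const r (1 : ℝ)).div hd (by positivity)).congr_deriv ?_
    field_simp
    ring

/-- The period function is an integral of a smooth function of `q` over
`[arctan ((p² - 1/2) / q), π/2]`, and its derivative follows by the Leibniz rule. -/
theorem hasDerivAt_Tplus {p q : ℝ} (hp : 0 < p) (hq : 0 < q) :
    HasDerivAt (fun x => Tplus p x)
      ((∫ θ in arctan ((p ^ 2 - 1 / 2) / q)..π / 2,
          -sin θ / (4 * √(1 / 2 + √(q ^ 2 + (p ^ 2 - 1 / 2) ^ 2) * sin θ) ^ 3)) *
          (q / √(q ^ 2 + (p ^ 2 - 1 / 2) ^ 2)) +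
        (p ^ 2 - 1 / 2) / (q ^ 2 + (p ^ 2 - 1 / 2) ^ 2) / (2 * p)) q := by
  set c := p ^ 2 - 1 / 2 with hc
  have hpi : ∀ x, arctan (c / x) ≤ π / 2 := fun x => (arctan_lt_pi_div_two _).le
  have hR : HasDerivAt (fun x => √(x ^ 2 + c ^ 2)) (q / √(q ^ 2 + c ^ 2)) q := by
    refine (((hasDerivAt_pow 2 q).add_const (c ^ 2)).sqrt (by positivity)).congr_deriv ?_
    push_cast
    field_simp
  have hα : HasDerivAt (fun x => arctan (c / x)) (-(c / (q ^ 2 + c ^ 2))) q := by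
    refine ((hasDerivAt_const q c).div (hasDerivAt_id' q) hq.ne').arctan.congr_deriv ?_
    simp only [Pi.div_apply]
    field_simp
    ring
  have hw : ∀ θ ∈ uIcc (arctan (c / q)) (π / 2), p ^ 2 ≤ 1 / 2 + √(q ^ 2 + c ^ 2) * sin θ :=
    fun θ hθ => sq_le_half_add_sqrt_mul_sin hq (by rwa [uIcc_of_le (hpi q)] at hθ)
  have hintegrable : ∀ x y, (∀ θ ∈ Icc (arctan (c / y)) (π / 2),
      0 < 1 / 2 + √(x ^ 2 + c ^ 2) * sin θ) → IntervalIntegrable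
        (fun θ => 1 / (2 * √(1 / 2 + √(x ^ 2 + c ^ 2) * sin θ))) volume
        (arctan (c / y)) (π / 2) := by
    intro x y h
    refine ContinuousOn.intervalIntegrable fun θ hθ => ?_
    rw [uIcc_of_le (hpi y)] at hθ
    have := sqrt_pos.2 (h θ hθ)
    exact ContinuousAt.continuousWithinAt (by fun_prop (disch := positivity))
  have hstart : √(1 / 2 + √(q ^ 2 + c ^ 2) * sin (arctan (c / q))) = p := by
    rw [sqrt_mul_sin_arctan_div _ hq, hc, add_sub_cancel, sqrt_sq hp.le]
  have hfixed := (hasDerivAt_integral_one_div_sqrt_s8 (by positivity) hw).comp q hR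
  have hleib := hasDerivAt_integral_of_lower_limit
    (F := fun x θ => 1 / (2 * √(1 / 2 + √(x ^ 2 + c ^ 2) * sin θ))) ?_ hα ?_ ?_ hfixed
  · rw [hstart] at hleib
    refine (hleib.congr_of_eventuallyEq ?_).congr_deriv (by ring)
    filter_upwards [lt_mem_nhds hq] with x hx
    rw [Tplus, integral_div_sqrt_energy (fun _ => 1) hp hx]
  · have : 0 < √(1 / 2 + √(q ^ 2 + c ^ 2) * sin (arctan (c / q))) := hstart ▸ hp
    unfold Function.uncurry
    fun_prop (disch := positivity)
  · filter_upwards [lt_mem_nhds hq] with x hx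
    exact hintegrable x x fun θ hθ =>
      (by positivity : 0 < p ^ 2).trans_le (sq_le_half_add_sqrt_mul_sin hx hθ)
  · filter_upwards [hR.continuousAt (Metric.ball_mem_nhds _ (by positivity : 0 < p ^ 2))] with x hx
    refine hintegrable x q fun θ hθ => ?_
    have hx' : |√(x ^ 2 + c ^ 2) - √(q ^ 2 + c ^ 2)| < p ^ 2 := by
      simpa [Real.dist_eq] using hx
    have h1 : |(√(x ^ 2 + c ^ 2) - √(q ^ 2 + c ^ 2)) * sin θ| < p ^ 2 := by
      rw [abs_mul]
      exact (mul_le_of_le_one_right (abs_nonneg _) (abs_sin_le_one θ)).trans_lt hx'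
    have h2 := hw θ (by rwa [uIcc_of_le (hpi q)])
    linarith [neg_abs_le ((√(x ^ 2 + c ^ 2) - √(q ^ 2 + c ^ 2)) * sin θ)]

/-- for every `p₀ ∈ (0,1)` and `q₀ > 0`, `T₊(p₀,·)` is differentiable at `q₀` and,
with `E = q₀² − A(p₀)`,
`((E + 1/4)/(2q₀)) ∂T₊/∂q₀ = ∫_{p₀}^{p₊} (1−2u²)/(8u²√(E+A(u))) du − (1−2p₀²)/(8p₀q₀)`. -/
theorem Tplus_deriv_identity (p₀ q₀ : ℝ) (hp₀ : p₀ ∈ Set.Ioo (0 : ℝ) 1) (hq₀ : 0 < q₀) :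
    DifferentiableAt ℝ (fun q => Tplus p₀ q) q₀ ∧
    ((q₀ ^ 2 - A p₀) + 1 / 4) / (2 * q₀) * deriv (fun q => Tplus p₀ q) q₀ =
      (∫ u in p₀..pPlus (q₀ ^ 2 - A p₀),
        (1 - 2 * u ^ 2) / (8 * u ^ 2 * Real.sqrt ((q₀ ^ 2 - A p₀) + A u)))
      - (1 - 2 * p₀ ^ 2) / (8 * p₀ * q₀) := by
  have hp := hp₀.1
  have hder := hasDerivAt_Tplus hp hq₀
  refine ⟨hder.differentiableAt, ?_⟩
  have hsub := integral_div_sqrt_energy (fun u => (1 - 2 * u ^ 2) / (8 * u ^ 2)) hp hq₀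
  simp only [div_div] at hsub
  rw [hder.deriv, hsub]
  set R := √(q₀ ^ 2 + (p₀ ^ 2 - 1 / 2) ^ 2) with hR
  have hR2 : R ^ 2 = q₀ ^ 2 + (p₀ ^ 2 - 1 / 2) ^ 2 := sq_sqrt (by positivity)
  have hR0 : 0 < R := sqrt_pos.2 (by positivity)
  have hE : q₀ ^ 2 - A p₀ + 1 / 4 = R ^ 2 := by rw [hR2, A]; ring
  have hFi : ∫ θ in arctan ((p₀ ^ 2 - 1 / 2) / q₀)..π / 2,
      (1 - 2 * √(1 / 2 + R * sin θ) ^ 2) /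
        (8 * √(1 / 2 + R * sin θ) ^ 2 * (2 * √(1 / 2 + R * sin θ))) =
      R / 2 * ∫ θ in arctan ((p₀ ^ 2 - 1 / 2) / q₀)..π / 2,
        -sin θ / (4 * √(1 / 2 + R * sin θ) ^ 3) := by
    rw [← intervalIntegral.integral_const_mul]
    refine intervalIntegral.integral_congr fun θ hθ => ?_
    rw [uIcc_of_le (arctan_lt_pi_div_two _).le] at hθ
    have hw : 0 < 1 / 2 + R * sin θ :=
      (by positivity : 0 < p₀ ^ 2).trans_le (sq_le_half_add_sqrt_mul_sin hq₀ hθ)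
    have hs := sqrt_pos.2 hw
    have hnum : 1 - 2 * √(1 / 2 + R * sin θ) ^ 2 = -2 * R * sin θ := by
      rw [sq_sqrt hw.le]; ring
    simp only [hnum]
    field_simp
    ring
  rw [hFi, hE, ← hR2]
  field_simp
  ring
end
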